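/- arXiv:1602.07422 — 2 statements merged into one kernel-verified Lean document; each statement's English description precedes it below -/
import Mathlib

section
/- Let (x, z, y) be a vertex solution (extreme point) of the polytope P = LP_RRST(E_X, V_X, E_Y, V_Y, E_Z, L) such that x_e > 0 for every e ∈ E_X, y_e > 0 for every e ∈ E_Y, and z_e > 0 for every e ∈ E_Z, where E_X, E_Y, E_Z are all nonempty. Then there exists an edge e' ∈ E_X with x_{e'} = 1, or an edge e'' ∈ E_Y with y_{e''} = 1. -/
open Finset

/-- The set `E(U)` of edges of `E` having both endpoints in `U`
(edges are given by an endpoint map `p`). -/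
def edgesIn {V ε : Type*} [DecidableEq V] (p : ε → V × V)
    (E : Finset ε) (U : Finset V) : Finset ε :=
  E.filter fun e => (p e).1 ∈ U ∧ (p e).2 ∈ U

/-- The (multi)graph on vertex set `V` with edge set `E` (endpoints given by `p`)
is connected: every nonempty proper vertex subset is left by some edge. -/
def ConnectedOn {V ε : Type*} [Fintype V] [DecidableEq V]
    (p : ε → V × V) (E : Finset ε) : Prop :=
  ∀ U : Finset V, U.Nonempty → U ≠ Finset.univ →
    ∃ e ∈ E, ((p e).1 ∈ U ∧ (p e).2 ∉ U) ∨ ((p e).1 ∉ U ∧ (p e).2 ∈ U)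

/-- The feasible region of the linear program `LP_RRST(E_X, V_X, E_Y, V_Y, E_Z, L)`,
viewed inside `ℝ^{E_X} × ℝ^{E_Z} × ℝ^{E_Y}` (coordinates outside the respective edge
sets are fixed to `0`). -/
def LP_RRST {V W ε : Type*} [Fintype V] [Fintype W] [DecidableEq V] [DecidableEq W] [DecidableEq ε]
    (pX : ε → V × V) (pY : ε → W × W) (EX EY EZ : Finset ε) (L : ℕ) :
    Set ((ε → ℝ) × (ε → ℝ) × (ε → ℝ)) :=
  {q | (∀ e, 0 ≤ q.1 e) ∧ (∀ e, 0 ≤ q.2.1 e) ∧ (∀ e, 0 ≤ q.2.2 e) ∧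
       (∀ e ∉ EX, q.1 e = 0) ∧ (∀ e ∉ EZ, q.2.1 e = 0) ∧ (∀ e ∉ EY, q.2.2 e = 0) ∧
       (∑ e ∈ EX, q.1 e = (Fintype.card V : ℝ) - 1) ∧
       (∀ U : Finset V, U.Nonempty → U ≠ Finset.univ →
         ∑ e ∈ edgesIn pX EX U, q.1 e ≤ (U.card : ℝ) - 1) ∧
       (∀ e ∈ EX ∩ EZ, q.2.1 e ≤ q.1 e) ∧
       (∑ e ∈ EZ, q.2.1 e = (L : ℝ)) ∧
       (∀ e ∈ EY ∩ EZ, q.2.1 e ≤ q.2.2 e) ∧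
       (∑ e ∈ EY, q.2.2 e = (Fintype.card W : ℝ) - 1) ∧
       (∀ U : Finset W, U.Nonempty → U ≠ Finset.univ →
         ∑ e ∈ edgesIn pY EY U, q.2.2 e ≤ (U.card : ℝ) - 1)}

/-- The net flow out of the node `n` carried by the arcs `I` (with sources `s` and targets `t`)
under the flow `u`. -/
def netFlow {ι N : Type*} [DecidableEq N] (I : Finset ι) (s t : ι → N) (u : ι → ℝ) (n : N) : ℝ :=
  ∑ i ∈ I, (if s i = n then u i else 0) - ∑ i ∈ I, (if t i = n then u i else 0)

/-- A nowhere integral flow on a nonempty finite digraph with integral net flow at every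
node cannot be unique: the digraph carries a nonzero circulation. -/
theorem exists_circulation {ι N : Type*} [DecidableEq ι] [DecidableEq N]
    (I : Finset ι) (hI : I.Nonempty)
    (s t : ι → N) (u : ι → ℝ) (hu : ∀ i ∈ I, ∀ k : ℤ, u i ≠ k)
    (hnet : ∀ n, ∃ k : ℤ, netFlow I s t u n = k) :
    ∃ d : ι → ℝ, (∃ i ∈ I, d i ≠ 0) ∧ ∀ n, netFlow I s t d n = 0 := by
  set M : Finset N := I.image s ∪ I.image t with hM
  have hs : ∀ i ∈ I, s i ∈ M := fun i hi => mem_union_left _ (mem_image_of_mem _ hi)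
  have ht : ∀ i ∈ I, t i ∈ M := fun i hi => mem_union_right _ (mem_image_of_mem _ hi)
  have hdeg : ∀ n ∈ M, 2 ≤ #{i ∈ I | s i = n} + #{i ∈ I | t i = n} := by
    intro n hn
    by_contra hlt
    obtain ⟨k, hk⟩ := hnet n
    simp only [netFlow, ← sum_filter] at hk
    have hpos : 0 < #{i ∈ I | s i = n} + #{i ∈ I | t i = n} := by
      rcases mem_union.1 hn with h | h <;> obtain ⟨i, hi, rfl⟩ := mem_image.1 h
      · have : 0 < #{j ∈ I | s j = s i} := card_pos.2 ⟨i, by simp [hi]⟩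
        omega
      · have : 0 < #{j ∈ I | t j = t i} := card_pos.2 ⟨i, by simp [hi]⟩
        omega
    have hcases : (#{i ∈ I | s i = n} = 1 ∧ #{i ∈ I | t i = n} = 0) ∨
        (#{i ∈ I | s i = n} = 0 ∧ #{i ∈ I | t i = n} = 1) := by omega
    rcases hcases with ⟨h1, h0⟩ | ⟨h0, h1⟩ <;> obtain ⟨i, hi⟩ := card_eq_one.1 h1 <;>
      have hiI : i ∈ I := (mem_filter.1 (hi ▸ mem_singleton_self i)).1 <;>
      rw [hi, card_eq_zero.1 h0] at hk
    · exact hu i hiI k (by simpa using hk)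
    · exact hu i hiI (-k) (by push_cast; simp at hk; linarith)
  have hcard : #M ≤ #I := by
    have h1 := card_eq_sum_card_fiberwise (f := s) (s := I) (t := M) hs
    have h2 := card_eq_sum_card_fiberwise (f := t) (s := I) (t := M) ht
    have h3 := sum_le_sum hdeg
    rw [sum_add_distrib, sum_const, smul_eq_mul] at h3
    omega
  let ext : (I → ℝ) →ₗ[ℝ] ι → ℝ :=
    { toFun := fun v i => if h : i ∈ I then v ⟨i, h⟩ else 0
      map_add' := fun v w => by ext i; by_cases h : i ∈ I <;> simp [h]
      map_smul' := fun c v => by ext i; by_cases h : i ∈ I <;> simp [h] }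
  let φ : (I → ℝ) →ₗ[ℝ] M → ℝ :=
    { toFun := fun v n => netFlow I s t (ext v) n
      map_add' := fun v w => by
        ext n
        simp only [netFlow, map_add, Pi.add_apply, ← sum_filter, sum_add_distrib]
        ring
      map_smul' := fun c v => by
        ext n
        simp only [netFlow, map_smul, Pi.smul_apply, smul_eq_mul, ← sum_filter, ← mul_sum,
          RingHom.id_apply]
        ring }
  have hsum : ∀ v, ∑ n, φ v n = 0 := by
    intro v
    change ∑ n : M, netFlow I s t (ext v) n = 0
    rw [sum_coe_sort M (fun n => netFlow I s t (ext v) n)]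
    simp only [netFlow, sum_sub_distrib]
    rw [sum_comm, sum_comm (s := M), ← sum_sub_distrib]
    refine sum_eq_zero fun i hi => ?_
    simp [hs i hi, ht i hi]
  have hinj : ¬ Function.Injective φ := by
    intro hinj
    have hle := LinearMap.finrank_le_finrank_of_injective hinj
    simp only [Module.finrank_fintype_fun_eq_card, Fintype.card_coe] at hle
    have hsurj : Function.Surjective φ :=
      (LinearMap.injective_iff_surjective_of_finrank_eq_finrank
        (by simpa using le_antisymm hle hcard)).1 hinj
    obtain ⟨i, hi⟩ := hI
    obtain ⟨v, hv⟩ := hsurj (Pi.single ⟨s i, hs i hi⟩ 1)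
    have := hsum v
    rw [hv] at this
    simp at this
  obtain ⟨v, hv, hv0⟩ : ∃ v, φ v = 0 ∧ v ≠ 0 := by
    by_contra! h
    exact hinj ((injective_iff_map_eq_zero φ).2 h)
  obtain ⟨⟨i, hi⟩, hvi⟩ := Function.ne_iff.1 hv0
  refine ⟨ext v, ⟨i, hi, by simpa [ext, hi] using hvi⟩, fun n => ?_⟩
  by_cases hn : n ∈ M
  · exact congrFun hv ⟨n, hn⟩
  · have h1 : ∀ i ∈ I, s i ≠ n := fun i hi h => hn (h ▸ hs i hi)
    have h2 : ∀ i ∈ I, t i ≠ n := fun i hi h => hn (h ▸ ht i hi)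
    simp only [netFlow]
    rw [sum_eq_zero fun i hi => if_neg (h1 i hi), sum_eq_zero fun i hi => if_neg (h2 i hi),
      sub_zero]

/-- If an intersection-closed family of finite sets has integral `x`-sums, so does every set
obtained from a member `D` by removing finitely many members. -/
theorem integral_sum_diff {ε κ : Type*} [DecidableEq ε] [DecidableEq κ] (x : ε → ℝ)
    (G : Finset ε → Prop) (hG : ∀ S T, G S → G T → G (S ∩ T))
    (hint : ∀ S, G S → ∃ k : ℤ, ∑ e ∈ S, x e = k) (F : κ → Finset ε) (R : Finset κ)
    (hR : ∀ i ∈ R, G (F i)) (D : Finset ε) (hD : G D) :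
    ∃ k : ℤ, ∑ e ∈ D with ∀ i ∈ R, e ∉ F i, x e = k := by
  induction R using Finset.induction_on generalizing D with
  | empty => simpa using hint D hD
  | insert a R _ ih =>
    have hR' : ∀ i ∈ R, G (F i) := fun i hi => hR i (mem_insert_of_mem hi)
    obtain ⟨k, hk⟩ := ih hR' D hD
    obtain ⟨l, hl⟩ := ih hR' _ (hG _ _ hD (hR a (mem_insert_self _ _)))
    refine ⟨k - l, ?_⟩
    have h := sum_filter_add_sum_filter_not ({e ∈ D | ∀ i ∈ R, e ∉ F i}) (fun e => e ∈ F a) x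
    have h1 : {e ∈ {e ∈ D | ∀ i ∈ R, e ∉ F i} | e ∈ F a} =
        {e ∈ D ∩ F a | ∀ i ∈ R, e ∉ F i} := by
      ext e; simp only [mem_filter, mem_inter]; tauto
    have h2 : {e ∈ {e ∈ D | ∀ i ∈ R, e ∉ F i} | e ∉ F a} =
        {e ∈ D | ∀ i ∈ insert a R, e ∉ F i} := by
      ext e; simp only [mem_filter, forall_mem_insert]; tauto
    rw [h1, h2] at h
    push_cast
    linarith

/-- If an intersection-closed family of finite sets has integral `x`-sums, so does every set
obtained from a member `D` by intersecting with and removing finitely many members. -/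
theorem integral_sum_inter_diff {ε κ : Type*} [DecidableEq ε] [DecidableEq κ] (x : ε → ℝ)
    (G : Finset ε → Prop) (hG : ∀ S T, G S → G T → G (S ∩ T))
    (hint : ∀ S, G S → ∃ k : ℤ, ∑ e ∈ S, x e = k) (F : κ → Finset ε) (Q R : Finset κ)
    (hQ : ∀ i ∈ Q, G (F i)) (hR : ∀ i ∈ R, G (F i)) (D : Finset ε) (hD : G D) :
    ∃ k : ℤ, ∑ e ∈ D with (∀ i ∈ Q, e ∈ F i) ∧ ∀ i ∈ R, e ∉ F i, x e = k := by
  induction Q using Finset.induction_on generalizing D with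
  | empty => simpa using integral_sum_diff x G hG hint F R hR D hD
  | insert a Q _ ih =>
    obtain ⟨k, hk⟩ := ih (fun i hi => hQ i (mem_insert_of_mem hi)) _
      (hG _ _ hD (hQ a (mem_insert_self _ _)))
    refine ⟨k, hk ▸ sum_congr ?_ fun _ _ => rfl⟩
    ext e; simp only [mem_filter, mem_inter, forall_mem_insert]; tauto

/-- Two subtour constraints tight at `x` whose vertex sets meet have a tight intersection. -/
theorem tight_inter {V ε : Type*} [DecidableEq V] [DecidableEq ε] (p : ε → V × V)
    (E : Finset ε) (x : ε → ℝ) (hx : ∀ e, 0 ≤ x e)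
    (hsub : ∀ U : Finset V, U.Nonempty → ∑ e ∈ edgesIn p E U, x e ≤ (#U : ℝ) - 1)
    {S T : Finset V} (hST : (S ∩ T).Nonempty)
    (hS : ∑ e ∈ edgesIn p E S, x e = (#S : ℝ) - 1)
    (hT : ∑ e ∈ edgesIn p E T, x e = (#T : ℝ) - 1) :
    ∑ e ∈ edgesIn p E (S ∩ T), x e = (#(S ∩ T) : ℝ) - 1 := by
  have h1 : edgesIn p E S ∩ edgesIn p E T = edgesIn p E (S ∩ T) := by
    ext e; simp only [edgesIn, mem_filter, mem_inter]; tauto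
  have h2 : edgesIn p E S ∪ edgesIn p E T ⊆ edgesIn p E (S ∪ T) := by
    intro e; simp only [edgesIn, mem_filter, mem_union]; tauto
  have h3 := sum_le_sum_of_subset_of_nonneg h2 (f := x) fun e _ _ => hx e
  have h4 := sum_union_inter (s₁ := edgesIn p E S) (s₂ := edgesIn p E T) (f := x)
  have h5 := hsub _ hST
  have h6 := hsub (S ∪ T) (hST.mono (inter_subset_left.trans subset_union_left))
  have h7 : (#(S ∪ T) : ℝ) + #(S ∩ T) = #S + #T := mod_cast card_union_add_card_inter S T
  rw [h1] at h4
  linarith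

/-- The edges can be partitioned (by a labelling `c`) into blocks with integral `x`-sums such that
every tight subtour constraint is a union of blocks. -/
theorem exists_tight_blocks {V ε : Type*} [Fintype V] [DecidableEq V] [DecidableEq ε]
    (p : ε → V × V) (E : Finset ε) (x : ε → ℝ) (hx : ∀ e, 0 ≤ x e) [Nonempty V]
    (hE : ∑ e ∈ E, x e = (Fintype.card V : ℝ) - 1)
    (hsub : ∀ U : Finset V, U.Nonempty → ∑ e ∈ edgesIn p E U, x e ≤ (#U : ℝ) - 1) :
    ∃ c : ε → Finset (Finset V),
      (∀ b, ∃ k : ℤ, ∑ e ∈ E, (if c e = b then x e else 0) = k) ∧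
      ∀ d : ε → ℝ, (∀ b, ∑ e ∈ E, (if c e = b then d e else 0) = 0) →
        ∀ U : Finset V, U.Nonempty → ∑ e ∈ edgesIn p E U, x e = (#U : ℝ) - 1 →
          ∑ e ∈ edgesIn p E U, d e = 0 := by
  classical
  let T : Finset (Finset V) :=
    {U | U.Nonempty ∧ ∑ e ∈ edgesIn p E U, x e = (#U : ℝ) - 1}
  have hTmem : ∀ U, U ∈ T ↔ U.Nonempty ∧ ∑ e ∈ edgesIn p E U, x e = (#U : ℝ) - 1 := by
    simp [T]
  let G : Finset ε → Prop := fun S => S = ∅ ∨ ∃ U ∈ T, S = edgesIn p E U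
  have huniv : edgesIn p E univ = E := by simp [edgesIn]
  have hGE : G E := Or.inr ⟨univ, by simp [hTmem, huniv, hE, univ_nonempty], huniv.symm⟩
  have hG : ∀ S R, G S → G R → G (S ∩ R) := by
    rintro S R (rfl | ⟨U, hU, rfl⟩) (rfl | ⟨U', hU', rfl⟩)
    · simp [G]
    · simp [G]
    · simp [G]
    have h1 : edgesIn p E U ∩ edgesIn p E U' = edgesIn p E (U ∩ U') := by
      ext e; simp only [edgesIn, mem_filter, mem_inter]; tauto
    rw [h1]
    rcases (U ∩ U').eq_empty_or_nonempty with h | h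
    · left; simp [h, edgesIn]
    · exact Or.inr ⟨_, (hTmem _).2 ⟨h, tight_inter p E x hx hsub h ((hTmem U).1 hU).2
        ((hTmem U').1 hU').2⟩, rfl⟩
  have hint : ∀ S, G S → ∃ k : ℤ, ∑ e ∈ S, x e = k := by
    rintro S (rfl | ⟨U, hU, rfl⟩)
    · exact ⟨0, by simp⟩
    · exact ⟨#U - 1, by rw [((hTmem U).1 hU).2]; simp⟩
  refine ⟨fun e => {U ∈ T | e ∈ edgesIn p E U}, fun b => ?_, fun d hd U hU hUt => ?_⟩
  · rw [← sum_filter]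
    by_cases hb : b ⊆ T
    · obtain ⟨k, hk⟩ := integral_sum_inter_diff x G hG hint (edgesIn p E) b (T \ b)
        (fun U hU => Or.inr ⟨U, hb hU, rfl⟩)
        (fun U hU => Or.inr ⟨U, (mem_sdiff.1 hU).1, rfl⟩) E hGE
      refine ⟨k, Eq.trans (sum_congr ?_ fun _ _ => rfl) hk⟩
      ext e
      simp only [Finset.ext_iff, mem_filter, mem_sdiff]
      refine and_congr_right fun _ => ?_
      constructor
      · intro h
        exact ⟨fun U hU => ((h U).2 hU).2, fun U hU he => hU.2 ((h U).1 ⟨hU.1, he⟩)⟩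
      · rintro ⟨h1, h2⟩ U
        exact ⟨fun h => by_contra fun hn => h2 U ⟨h.1, hn⟩ h.2, fun h => ⟨hb h, h1 U h⟩⟩
    · refine ⟨0, ?_⟩
      rw [filter_false_of_mem]
      · simp
      · rintro e _ rfl
        exact hb (filter_subset _ _)
  · set c : ε → Finset (Finset V) := fun e => {U ∈ T | e ∈ edgesIn p E U} with hc
    have hUT : U ∈ T := (hTmem U).2 ⟨hU, hUt⟩
    have h1 : edgesIn p E U = {e ∈ E | U ∈ c e} := by
      ext e; simp [hc, hUT, edgesIn]
    rw [h1, ← sum_fiberwise_of_maps_to (g := c) (t := {b ∈ E.image c | U ∈ b})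
      (fun e he => by
        have := mem_filter.1 he
        exact mem_filter.2 ⟨mem_image_of_mem _ this.1, this.2⟩)]
    refine sum_eq_zero fun b hb => ?_
    rw [← hd b, ← sum_filter, filter_filter]
    refine sum_congr (filter_congr fun e _ => ?_) fun _ _ => rfl
    exact ⟨fun h => h.2, fun h => ⟨h ▸ (mem_filter.1 hb).2, h⟩⟩

/-- The subtour bound holds for all nonempty vertex sets, the full one included. -/
theorem subtour_le {V ε : Type*} [Fintype V] [DecidableEq V]
    (p : ε → V × V) (E : Finset ε) (x : ε → ℝ)
    (hE : ∑ e ∈ E, x e = (Fintype.card V : ℝ) - 1)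
    (hsub : ∀ U : Finset V, U.Nonempty → U ≠ univ →
      ∑ e ∈ edgesIn p E U, x e ≤ (#U : ℝ) - 1) (U : Finset V) (hU : U.Nonempty) :
    ∑ e ∈ edgesIn p E U, x e ≤ (#U : ℝ) - 1 := by
  by_cases h : U = univ
  · subst h
    simp [edgesIn, hE]
  · exact hsub U hU h

/-- The subtour bounds force every coordinate to be at most one. -/
theorem le_one_of_subtour {V ε : Type*} [DecidableEq V]
    (p : ε → V × V) (E : Finset ε) (x : ε → ℝ) (hx : ∀ e, 0 ≤ x e)
    (hsub : ∀ U : Finset V, U.Nonempty → ∑ e ∈ edgesIn p E U, x e ≤ (#U : ℝ) - 1)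
    {e : ε} (he : e ∈ E) : x e ≤ 1 := by
  have h1 := hsub {(p e).1, (p e).2} (by simp)
  have h2 : x e ≤ ∑ e ∈ edgesIn p E {(p e).1, (p e).2}, x e :=
    single_le_sum (fun i _ => hx i) (by simp [edgesIn, he])
  have h3 : (#{(p e).1, (p e).2} : ℝ) ≤ 2 := mod_cast card_le_two
  linarith

/-- The arcs of the auxiliary digraph: one for each `x`-coordinate, one for each `y`-coordinate not
identified with an `x`-coordinate, and one for each `z`-coordinate identified with neither. -/
def rrstArcs {ε : Type*} [DecidableEq ε] (EX EY EZ A B : Finset ε) : Finset (ε ⊕ ε ⊕ ε) :=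
  EX.disjSum ((EY \ (A ∩ B)).disjSum (EZ \ (A ∪ B)))

/-- Sources of the arcs; the last summand holds the node of the cardinality constraint (`true`)
and the root (`false`). -/
def rrstSource {ε α β : Type*} [DecidableEq ε] (cX : ε → α) (B : Finset ε) :
    ε ⊕ ε ⊕ ε → α ⊕ β ⊕ Bool :=
  Sum.elim (fun e => Sum.inl (cX e))
    (Sum.elim (fun e => Sum.inr (Sum.inr (decide (e ∈ B)))) fun _ => Sum.inr (Sum.inr true))

/-- Targets of the arcs. -/
def rrstTarget {ε α β : Type*} [DecidableEq ε] (cY : ε → β) (A B : Finset ε) :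
    ε ⊕ ε ⊕ ε → α ⊕ β ⊕ Bool :=
  Sum.elim
    (fun e => if e ∈ A ∩ B then Sum.inr (Sum.inl (cY e)) else Sum.inr (Sum.inr (decide (e ∉ A))))
    (Sum.elim (fun e => Sum.inr (Sum.inl (cY e))) fun _ => Sum.inr (Sum.inr false))

/-- The net flow out of a block of `x`-edges is the `x`-sum over the block. -/
theorem netFlow_rrst_inl {ε α β : Type*} [DecidableEq ε] [DecidableEq α] [DecidableEq β]
    (cX : ε → α) (cY : ε → β) (EX EY EZ A B : Finset ε) (x z y : ε → ℝ) (b : α) :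
    netFlow (rrstArcs EX EY EZ A B) (rrstSource (β := β) cX B) (rrstTarget cY A B)
      (Sum.elim x (Sum.elim y z)) (Sum.inl b) = ∑ e ∈ EX, if cX e = b then x e else 0 := by
  simp only [netFlow, rrstArcs, sum_disjSum, rrstSource, rrstTarget, Sum.elim_inl, Sum.elim_inr,
    Sum.inl.injEq, reduceCtorEq, if_false, sum_const_zero, add_zero]
  rw [sub_eq_self]
  exact sum_eq_zero fun e _ => if_neg (by split_ifs <;> simp)

/-- The net flow out of a block of `y`-edges, the root and the cardinality node. -/
theorem netFlow_rrst_inr {ε α β : Type*} [DecidableEq ε] [DecidableEq α] [DecidableEq β]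
    (cX : ε → α) (cY : ε → β) (EX EY EZ A B : Finset ε) (x z y : ε → ℝ)
    (hA : A ⊆ EX ∩ EZ) (hB : B ⊆ EY ∩ EZ) (hzx : ∀ e ∈ A, z e = x e)
    (hzy : ∀ e ∈ B, z e = y e) (v : β ⊕ Bool) :
    netFlow (rrstArcs EX EY EZ A B) (rrstSource cX B) (rrstTarget cY A B)
      (Sum.elim x (Sum.elim y z)) (Sum.inr v) =
        Sum.elim (fun b => -∑ e ∈ EY, if cY e = b then y e else 0)
          (fun r => if r then ∑ e ∈ EZ, z e - ∑ e ∈ EX, x e else ∑ e ∈ EY, y e - ∑ e ∈ EZ, z e)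
          v := by
  obtain ⟨S, hS⟩ : ∃ S, EX ∪ EY ∪ EZ ⊆ S := ⟨_, subset_rfl⟩
  have hext : ∀ C ⊆ S, ∀ f : ε → ℝ, ∑ e ∈ C, f e = ∑ e ∈ S, if e ∈ C then f e else 0 := by
    intro C hC f
    rw [sum_ite_mem, inter_eq_right.2 hC]
  have hX : EX ⊆ S := fun e he => hS (by simp [he])
  have hY : EY ⊆ S := fun e he => hS (by simp [he])
  have hZ : EZ ⊆ S := fun e he => hS (by simp [he])
  rcases v with b | _ | _ <;>
    simp only [netFlow, rrstArcs, sum_disjSum, rrstSource, rrstTarget, Sum.elim_inl, Sum.elim_inr,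
      hext EX hX, hext EY hY, hext EZ hZ, hext _ (sdiff_subset.trans hY),
      hext _ (sdiff_subset.trans hZ), ← sum_add_distrib, ← sum_sub_distrib, ← sum_neg_distrib,
      if_true, if_false, Bool.false_eq_true] <;>
    refine sum_congr rfl fun e _ => ?_ <;>
    have hAe := @hA e <;> have hBe := @hB e <;> have hx := hzx e <;> have hy := hzy e <;>
    by_cases h1 : e ∈ A <;> by_cases h2 : e ∈ B <;> by_cases h3 : e ∈ EX <;>
    by_cases h4 : e ∈ EY <;> by_cases h5 : e ∈ EZ <;> simp_all

theorem eventually_add_mul_le {a b c : ℝ} (hac : a ≤ c) (h : a = c → b = 0) :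
    ∀ᶠ t in nhds (0 : ℝ), a + t * b ≤ c := by
  rcases hac.eq_or_lt with h' | h'
  · simp [h h', hac]
  · have : Filter.Tendsto (fun t : ℝ => a + t * b) (nhds 0) (nhds (a + 0 * b)) :=
      (by fun_prop : Continuous fun t : ℝ => a + t * b).tendsto 0
    exact (this.eventually_lt_const (by simpa using h')).mono fun _ => le_of_lt

/-- Spanning tree constraints survive a small perturbation which preserves the tight ones. -/
theorem eventually_subtour {V ε : Type*} [Fintype V] [DecidableEq V]
    (p : ε → V × V) (E : Finset ε) (x d : ε → ℝ)
    (hsub : ∀ U : Finset V, U.Nonempty → ∑ e ∈ edgesIn p E U, x e ≤ (#U : ℝ) - 1)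
    (hd : ∀ U : Finset V, U.Nonempty → ∑ e ∈ edgesIn p E U, x e = (#U : ℝ) - 1 →
      ∑ e ∈ edgesIn p E U, d e = 0) :
    ∀ᶠ t in nhds (0 : ℝ), ∀ U : Finset V, U.Nonempty → U ≠ univ →
      ∑ e ∈ edgesIn p E U, (x e + t * d e) ≤ (#U : ℝ) - 1 := by
  refine Filter.eventually_all.2 fun U => ?_
  by_cases hU : U.Nonempty
  · filter_upwards [eventually_add_mul_le (hsub U hU) (hd U hU)] with t ht _ _
    rwa [sum_add_distrib, ← mul_sum]
  · exact Filter.Eventually.of_forall fun t h => absurd h hU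

theorem eventually_nonneg {ε : Type*} (E : Finset ε) (x d : ε → ℝ) (hx : ∀ e ∈ E, 0 < x e)
    (hx0 : ∀ e ∉ E, x e = 0) (hd0 : ∀ e ∉ E, d e = 0) :
    ∀ᶠ t in nhds (0 : ℝ), ∀ e, 0 ≤ x e + t * d e := by
  have h : ∀ᶠ t in nhds (0 : ℝ), ∀ e ∈ E, -x e + t * -d e ≤ 0 :=
    (Filter.eventually_all_finset E).2 fun e he =>
      eventually_add_mul_le (by linarith [hx e he]) fun h => by linarith [hx e he]
  filter_upwards [h] with t ht e
  by_cases he : e ∈ E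
  · linarith [ht e he]
  · simp [hx0 e he, hd0 e he]

theorem eventually_coupled {ε : Type*} (E : Finset ε) (x z dx dz : ε → ℝ)
    (h : ∀ e ∈ E, z e ≤ x e) (hd : ∀ e ∈ E, z e = x e → dz e = dx e) :
    ∀ᶠ t in nhds (0 : ℝ), ∀ e ∈ E, z e + t * dz e ≤ x e + t * dx e := by
  have h' : ∀ᶠ t in nhds (0 : ℝ), ∀ e ∈ E, (z e - x e) + t * (dz e - dx e) ≤ 0 :=
    (Filter.eventually_all_finset E).2 fun e he =>
      eventually_add_mul_le (by linarith [h e he]) fun h' => by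
        linarith [hd e he (by linarith)]
  filter_upwards [h'] with t ht e he
  linarith [ht e he]

/-- A direction `d` in which one can move both ways from an extreme point vanishes. -/
theorem eq_zero_of_mem_extremePoints {M : Type*} [AddCommGroup M] [Module ℝ M] {P : Set M}
    {q d : M} (hq : q ∈ P.extremePoints ℝ) (h : ∀ᶠ t in nhds (0 : ℝ), q + t • d ∈ P) :
    d = 0 := by
  have hneg : ∀ᶠ t in nhds (0 : ℝ), q + (-t) • d ∈ P :=
    (by simpa using (continuous_neg (G := ℝ)).tendsto 0 :
      Filter.Tendsto (fun t : ℝ => -t) (nhds 0) (nhds 0)).eventually h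
  obtain ⟨t, ⟨h1, h2⟩, ht⟩ :=
    (((h.and hneg).filter_mono nhdsWithin_le_nhds).and
      (self_mem_nhdsWithin (s := {(0 : ℝ)}ᶜ))).exists
  have hseg : q ∈ openSegment ℝ (q + t • d) (q + (-t) • d) :=
    ⟨1 / 2, 1 / 2, by norm_num, by norm_num, by norm_num, by module⟩
  have := hq.2 h1 h2 hseg
  simpa [show t ≠ 0 from ht] using this

/-- If `(x, z, y)` is a vertex solution of
`LP_RRST(E_X, V_X, E_Y, V_Y, E_Z, L)` with all coordinates on `E_X`, `E_Y`, `E_Z`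
strictly positive (and `E_X`, `E_Y`, `E_Z` nonempty), then some `x_{e'} = 1` for an
edge `e' ∈ E_X` or some `y_{e''} = 1` for an edge `e'' ∈ E_Y`. -/
theorem vertex_has_integral_coordinate {V W ε : Type*}
    [Fintype V] [Fintype W] [DecidableEq V] [DecidableEq W] [DecidableEq ε]
    [Nonempty V] [Nonempty W]
    (pX : ε → V × V) (pY : ε → W × W) (EX EY EZ : Finset ε) (L : ℕ)
    (hconnX : ConnectedOn pX EX) (hconnY : ConnectedOn pY EY)
    (hEXne : EX.Nonempty) (hEYne : EY.Nonempty) (hEZne : EZ.Nonempty)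
    (hEZ : EZ ⊆ EX ∪ EY) (hL : L ≤ EZ.card)
    (x z y : ε → ℝ)
    (hvert : (x, z, y) ∈ Set.extremePoints ℝ (LP_RRST pX pY EX EY EZ L))
    (hx : ∀ e ∈ EX, 0 < x e) (hy : ∀ e ∈ EY, 0 < y e) (hz : ∀ e ∈ EZ, 0 < z e) :
    (∃ e' ∈ EX, x e' = 1) ∨ (∃ e'' ∈ EY, y e'' = 1) := by
  classical
  by_contra! hne
  obtain ⟨hneX, hneY⟩ := hne
  have hmem := hvert.1
  obtain ⟨hx0, hz0, hy0, hxE, hzE, hyE, hxV, hxU, hzx, hzL, hzy, hyW, hyU⟩ := hmem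
  dsimp only at hx0 hz0 hy0 hxE hzE hyE hxV hxU hzx hzL hzy hyW hyU
  have hxU' := subtour_le pX EX x hxV hxU
  have hyU' := subtour_le pY EY y hyW hyU
  have hx1 : ∀ e ∈ EX, x e < 1 := fun e he =>
    (le_one_of_subtour pX EX x hx0 hxU' he).lt_of_ne (hneX e he)
  have hy1 : ∀ e ∈ EY, y e < 1 := fun e he =>
    (le_one_of_subtour pY EY y hy0 hyU' he).lt_of_ne (hneY e he)
  obtain ⟨cX, hcX, hcX'⟩ := exists_tight_blocks pX EX x hx0 hxV hxU'
  obtain ⟨cY, hcY, hcY'⟩ := exists_tight_blocks pY EY y hy0 hyW hyU'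
  let A : Finset ε := {e ∈ EX ∩ EZ | z e = x e}
  let B : Finset ε := {e ∈ EY ∩ EZ | z e = y e}
  have hA : A ⊆ EX ∩ EZ := filter_subset _ _
  have hB : B ⊆ EY ∩ EZ := filter_subset _ _
  have hAz : ∀ e ∈ A, z e = x e := fun e he => (mem_filter.1 he).2
  have hBz : ∀ e ∈ B, z e = y e := fun e he => (mem_filter.1 he).2
  have hnotint : ∀ r : ℝ, 0 < r → r < 1 → ∀ k : ℤ, r ≠ k := by
    rintro r h0 h1 k rfl
    norm_cast at h0 h1
    omega
  have hz1 : ∀ e ∈ EZ, z e < 1 := fun e he => by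
    rcases mem_union.1 (hEZ he) with h | h
    · exact (hzx e (mem_inter.2 ⟨h, he⟩)).trans_lt (hx1 e h)
    · exact (hzy e (mem_inter.2 ⟨h, he⟩)).trans_lt (hy1 e h)
  obtain ⟨w, ⟨i, hi, hwi⟩, hw⟩ := exists_circulation (rrstArcs EX EY EZ A B)
    (by obtain ⟨e, he⟩ := hEXne; exact ⟨Sum.inl e, by simp [rrstArcs, he]⟩)
    (rrstSource cX B) (rrstTarget cY A B) (Sum.elim x (Sum.elim y z))
    (by
      rintro (e | e | e) he <;>
        simp only [rrstArcs, inl_mem_disjSum, inr_mem_disjSum, mem_sdiff] at he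
      · exact hnotint _ (hx e he) (hx1 e he)
      · exact hnotint _ (hy e he.1) (hy1 e he.1)
      · exact hnotint _ (hz e he.1) (hz1 e he.1))
    (by
      rintro (b | v)
      · rw [netFlow_rrst_inl]
        exact hcX b
      · rw [netFlow_rrst_inr cX cY EX EY EZ A B x z y hA hB hAz hBz]
        rcases v with b | _ | _
        · obtain ⟨k, hk⟩ := hcY b
          exact ⟨-k, by simp [hk]⟩
        · exact ⟨Fintype.card W - 1 - L, by simp [hyW, hzL]⟩
        · exact ⟨L - (Fintype.card V - 1), by simp [hxV, hzL]⟩)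
  let dx : ε → ℝ := fun e => if e ∈ EX then w (Sum.inl e) else 0
  let dy : ε → ℝ := fun e => if e ∈ A ∩ B then dx e else
    if e ∈ EY then w (Sum.inr (Sum.inl e)) else 0
  let dz : ε → ℝ := fun e => if e ∈ A then dx e else if e ∈ B then dy e else
    if e ∈ EZ then w (Sum.inr (Sum.inr e)) else 0
  have hdA : ∀ e ∈ A, dz e = dx e := fun e he => by simp [dz, he]
  have hdB : ∀ e ∈ B, dz e = dy e := fun e he => by
    by_cases h : e ∈ A <;> simp [dz, dy, he, h]
  have hwd : ∀ i ∈ rrstArcs EX EY EZ A B, w i = Sum.elim dx (Sum.elim dy dz) i := by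
    rintro (e | e | e) he <;>
      simp only [rrstArcs, inl_mem_disjSum, inr_mem_disjSum, mem_sdiff] at he
    · simp [dx, he]
    · simp only [Sum.elim_inr, Sum.elim_inl, dy, if_neg he.2, if_pos he.1]
    · have := he.2
      rw [mem_union, not_or] at this
      simp only [Sum.elim_inr, dz, if_neg this.1, if_neg this.2, if_pos he.1]
  have hflow : ∀ n, netFlow (rrstArcs EX EY EZ A B) (rrstSource cX B) (rrstTarget cY A B)
      (Sum.elim dx (Sum.elim dy dz)) n = 0 := fun n => by
    rw [← hw n]
    unfold netFlow
    congr 1 <;> exact sum_congr rfl fun i hi => by rw [hwd i hi]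
  have hdX := hcX' dx fun b =>
    (netFlow_rrst_inl cX cY EX EY EZ A B dx dz dy b).symm.trans (hflow (Sum.inl b))
  have hinr := fun v => (netFlow_rrst_inr cX cY EX EY EZ A B dx dz dy hA hB hdA hdB v).symm.trans
    (hflow (Sum.inr v))
  have hdY := hcY' dy fun b => neg_eq_zero.1 (hinr (Sum.inl b))
  have hdX0 : ∑ e ∈ EX, dx e = 0 := by
    simpa [edgesIn, hxV] using hdX univ univ_nonempty
  have hdY0 : ∑ e ∈ EY, dy e = 0 := by
    simpa [edgesIn, hyW] using hdY univ univ_nonempty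
  have hdZ0 : ∑ e ∈ EZ, dz e = 0 := by
    simpa [hdX0] using hinr (Sum.inr true)
  have hdxE : ∀ e ∉ EX, dx e = 0 := fun e he => by simp [dx, he]
  have hdyE : ∀ e ∉ EY, dy e = 0 := fun e he => by
    have : e ∉ B := fun h => he (mem_inter.1 (hB h)).1
    simp [dy, he, this]
  have hdzE : ∀ e ∉ EZ, dz e = 0 := fun e he => by
    have h1 : e ∉ A := fun h => he (mem_inter.1 (hA h)).2
    have h2 : e ∉ B := fun h => he (mem_inter.1 (hB h)).2
    simp [dz, he, h1, h2]
  have hev : ∀ᶠ t in nhds (0 : ℝ),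
      (x, z, y) + t • (dx, dz, dy) ∈ LP_RRST pX pY EX EY EZ L := by
    filter_upwards [eventually_nonneg EX x dx hx hxE hdxE, eventually_nonneg EY y dy hy hyE hdyE,
      eventually_nonneg EZ z dz hz hzE hdzE, eventually_subtour pX EX x dx hxU' hdX,
      eventually_subtour pY EY y dy hyU' hdY,
      eventually_coupled _ x z dx dz hzx fun e he h => hdA e (mem_filter.2 ⟨he, h⟩),
      eventually_coupled _ y z dy dz hzy fun e he h => hdB e (mem_filter.2 ⟨he, h⟩)]
      with t h1 h2 h3 h4 h5 h6 h7
    refine ⟨h1, h3, h2, fun e he => ?_, fun e he => ?_, fun e he => ?_, ?_, h4, h6, ?_, h7, ?_, h5⟩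
    · simp [hxE e he, hdxE e he]
    · simp [hzE e he, hdzE e he]
    · simp [hyE e he, hdyE e he]
    · simp [sum_add_distrib, ← mul_sum, hdX0, hxV]
    · simp [sum_add_distrib, ← mul_sum, hdZ0, hzL]
    · simp [sum_add_distrib, ← mul_sum, hdY0, hyW]
  have hzero := eq_zero_of_mem_extremePoints hvert hev
  simp only [Prod.mk_eq_zero] at hzero
  refine hwi ((hwd i hi).trans ?_)
  rw [hzero.1, hzero.2.1, hzero.2.2]
  rcases i with e | e | e <;> rfl
end

section
/- Let M_Y = (E_Y, I_Y) be a matroid on a nonempty finite ground set with rank function r_{M_Y}, let E_Z ⊆ E_Y, and let L be an integer with 0 ≤ L ≤ |E_Z|. Let Q be the polytope of vectors y ∈ ℝ^{E_Y} with y ≥ 0 satisfying Σ_{e∈E_Y} y_e = r_{M_Y}(E_Y), Σ_{e∈U} y_e ≤ r_{M_Y}(U) for every proper subset U ⊂ E_Y, and Σ_{e∈E_Z} y_e ≥ L. If y is a vertex solution (extreme point) of Q with y_e > 0 for every e ∈ E_Y, then there exists an element e' ∈ E_Y with y_{e'} = 1. -/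
open Finset

/-- A matroid `M = (E, I)` on a finite ground set, given by its finite ground set and
the family of independent sets. -/
structure FinMatroid (α : Type*) [DecidableEq α] where
  /-- the ground set -/
  E : Finset α
  /-- the independence predicate -/
  Indep : Finset α → Prop
  indep_subset_ground : ∀ ⦃A⦄, Indep A → A ⊆ E
  indep_empty : Indep ∅
  indep_subset : ∀ ⦃A B⦄, A ⊆ B → Indep B → Indep A
  indep_exchange : ∀ ⦃A B⦄, Indep A → Indep B → A.card < B.card →
    ∃ e ∈ B \ A, Indep (insert e A)

open scoped Classical in
/-- The rank function of a matroid: `r_M(U) = max {|W| : W ⊆ U, W ∈ I}`. -/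
noncomputable def FinMatroid.rank {α : Type*} [DecidableEq α]
    (M : FinMatroid α) (U : Finset α) : ℕ :=
  ((U.powerset.filter fun W => M.Indep W).image Finset.card).max'
    ⟨0, Finset.mem_image.2 ⟨∅, Finset.mem_filter.2
      ⟨Finset.mem_powerset.2 (Finset.empty_subset U), M.indep_empty⟩,
      Finset.card_empty⟩⟩

/-- The polytope `Q` of vectors `y ∈ ℝ^{E_Y}` (coordinates outside `E_Y` fixed to `0`)
satisfying the matroid rank constraints of `M_Y` together with
`∑_{e ∈ E_Z} y_e ≥ L`. -/
noncomputable def QPolytope {α : Type*} [DecidableEq α]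
    (MY : FinMatroid α) (EZ : Finset α) (L : ℕ) : Set (α → ℝ) :=
  {y | (∀ e, 0 ≤ y e) ∧ (∀ e ∉ MY.E, y e = 0) ∧
       (∑ e ∈ MY.E, y e = (MY.rank MY.E : ℝ)) ∧
       (∀ U : Finset α, U ⊂ MY.E → ∑ e ∈ U, y e ≤ (MY.rank U : ℝ)) ∧
       ((L : ℝ) ≤ ∑ e ∈ EZ, y e)}

namespace FinMatroid

variable {α : Type*} [DecidableEq α] (M : FinMatroid α)

lemma card_le_rank {W U : Finset α} (hWU : W ⊆ U) (hW : M.Indep W) : W.card ≤ M.rank U := by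
  classical
  exact Finset.le_max' _ _ (mem_image_of_mem _ (mem_filter.2 ⟨mem_powerset.2 hWU, hW⟩))

lemma exists_indep_card_eq_rank (U : Finset α) :
    ∃ W ⊆ U, M.Indep W ∧ W.card = M.rank U := by
  classical
  have h := Finset.max'_mem ((U.powerset.filter fun W => M.Indep W).image Finset.card)
    ⟨0, Finset.mem_image.2 ⟨∅, Finset.mem_filter.2
      ⟨Finset.mem_powerset.2 (Finset.empty_subset U), M.indep_empty⟩, Finset.card_empty⟩⟩
  obtain ⟨W, hW, hcard⟩ := mem_image.1 h
  obtain ⟨hWU, hWI⟩ := mem_filter.1 hW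
  exact ⟨W, mem_powerset.1 hWU, hWI, hcard⟩

lemma rank_le_card (U : Finset α) : M.rank U ≤ U.card := by
  obtain ⟨W, hWU, -, hW⟩ := M.exists_indep_card_eq_rank U
  exact hW ▸ card_le_card hWU

/-- An independent subset of `U` extends to an independent subset of size `M.rank U`. -/
lemma exists_superset_card_eq_rank {I U : Finset α} (hI : M.Indep I) (hIU : I ⊆ U) :
    ∃ J, I ⊆ J ∧ J ⊆ U ∧ M.Indep J ∧ J.card = M.rank U := by
  classical
  obtain ⟨J, hJ, hmax⟩ := (U.powerset.filter fun J => I ⊆ J ∧ M.Indep J).exists_max_image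
    Finset.card ⟨I, by simp [hI, hIU]⟩
  simp only [mem_filter, mem_powerset] at hJ hmax
  obtain ⟨hJU, hIJ, hJI⟩ := hJ
  refine ⟨J, hIJ, hJU, hJI, (M.card_le_rank hJU hJI).antisymm ?_⟩
  by_contra! hlt
  obtain ⟨W, hWU, hWI, hW⟩ := M.exists_indep_card_eq_rank U
  obtain ⟨e, he, hins⟩ := M.indep_exchange hJI hWI (hW ▸ hlt)
  obtain ⟨heW, heJ⟩ := mem_sdiff.1 he
  have := hmax (insert e J) ⟨insert_subset (hWU heW) hJU, hIJ.trans (subset_insert e J), hins⟩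
  rw [card_insert_of_notMem heJ] at this
  omega

lemma rank_submodular (A B : Finset α) :
    M.rank (A ∪ B) + M.rank (A ∩ B) ≤ M.rank A + M.rank B := by
  obtain ⟨I, hIAB, hI, hIcard⟩ := M.exists_indep_card_eq_rank (A ∩ B)
  obtain ⟨J, hIJ, hJ, hJI, hJcard⟩ := M.exists_superset_card_eq_rank hI
    (hIAB.trans (inter_subset_left.trans subset_union_left))
  have hA := M.card_le_rank (inter_subset_right (s₁ := J) (s₂ := A))
    (M.indep_subset inter_subset_left hJI)
  have hB := M.card_le_rank (inter_subset_right (s₁ := J) (s₂ := B))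
    (M.indep_subset inter_subset_left hJI)
  have hle : I.card ≤ (J ∩ A ∩ (J ∩ B)).card :=
    card_le_card fun x hx => by
      have := mem_inter.1 (hIAB hx)
      simp [hIJ hx, this.1, this.2]
  have hun : J ∩ A ∪ J ∩ B = J := by
    rw [← inter_union_distrib_left, inter_eq_left.2 hJ]
  have := card_union_add_card_inter (J ∩ A) (J ∩ B)
  rw [hun] at this
  omega

/-- The set `U` satisfies its rank constraint with equality at `y`. -/
def Tight (y : α → ℝ) (U : Finset α) : Prop :=
  U ⊆ M.E ∧ ∑ e ∈ U, y e = M.rank U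

variable {M} {y : α → ℝ}

lemma tight_empty : M.Tight y ∅ := by
  have := M.rank_le_card ∅
  rw [card_empty, Nat.le_zero] at this
  simp [Tight, this]

lemma Tight.union_inter (hle : ∀ U ⊆ M.E, ∑ e ∈ U, y e ≤ M.rank U) {A B : Finset α}
    (hA : M.Tight y A) (hB : M.Tight y B) : M.Tight y (A ∪ B) ∧ M.Tight y (A ∩ B) := by
  have hU := union_subset hA.1 hB.1
  have hI : A ∩ B ⊆ M.E := inter_subset_left.trans hA.1
  have h₁ := hle _ hU
  have h₂ := hle _ hI
  have h₃ := sum_union_inter (s₁ := A) (s₂ := B) (f := y)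
  have h₄ : (M.rank (A ∪ B) + M.rank (A ∩ B) : ℝ) ≤ M.rank A + M.rank B := by
    exact_mod_cast M.rank_submodular A B
  rw [hA.2, hB.2] at h₃
  exact ⟨⟨hU, by linarith⟩, ⟨hI, by linarith⟩⟩

/-- If the tight sets separate `e` from every other element, then `y e` is a difference of
two ranks. -/
lemma exists_add_eq_of_separated (hle : ∀ U ⊆ M.E, ∑ e ∈ U, y e ≤ M.rank U)
    (hE : M.Tight y M.E) {e : α} (he : e ∈ M.E)
    (hsep : ∀ f ∈ M.E, f ≠ e → ∃ U, M.Tight y U ∧ ¬(e ∈ U ↔ f ∈ U)) :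
    ∃ m n : ℕ, y e + m = n := by
  classical
  obtain ⟨D, hD, hmin⟩ := (M.E.powerset.filter fun U => M.Tight y U ∧ e ∈ U).exists_min_image
    Finset.card ⟨M.E, by simp [hE, he]⟩
  simp only [mem_filter, mem_powerset] at hD hmin
  obtain ⟨hDE, hDt, heD⟩ := hD
  have hDmin : ∀ U, M.Tight y U → e ∈ U → D ⊆ U := fun U hU heU => by
    have ht := (hDt.union_inter hle hU).2
    exact inter_eq_left.1 <| eq_of_subset_of_card_le inter_subset_left
      (hmin _ ⟨ht.1, ht, mem_inter.2 ⟨heD, heU⟩⟩)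
  obtain ⟨B, hB, hmax⟩ := (D.powerset.filter fun U => M.Tight y U ∧ e ∉ U).exists_max_image
    Finset.card ⟨∅, by simp [tight_empty]⟩
  simp only [mem_filter, mem_powerset] at hB hmax
  obtain ⟨hBD, hBt, heB⟩ := hB
  have hDB : D = insert e B := by
    refine Subset.antisymm (fun f hf => ?_) (insert_subset heD hBD)
    by_cases hfe : f = e
    · simp [hfe]
    obtain ⟨U, hU, hne⟩ := hsep f (hDE hf) hfe
    have heU : e ∉ U := fun h => hne ⟨fun _ => hDmin U hU h hf, fun _ => h⟩
    have hfU : f ∈ U := by_contra fun h => hne ⟨fun h' => absurd h' heU, fun h' => absurd h' h⟩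
    have ht := (hBt.union_inter hle (hU.union_inter hle hDt).2).1
    have hcard := hmax (B ∪ U ∩ D)
      ⟨union_subset hBD inter_subset_right, ht, by simp [heB, heU]⟩
    have heq := eq_of_subset_of_card_le subset_union_left hcard
    rw [heq]
    simp [hf, hfU]
  refine ⟨M.rank B, M.rank D, ?_⟩
  rw [← hBt.2, ← hDt.2, hDB, sum_insert heB]

end FinMatroid

lemma eq_one_of_add_natCast_eq {x : ℝ} {m n : ℕ} (h : x + m = n) (h₀ : 0 < x) (h₁ : x ≤ 1) :
    x = 1 := by
  have h₂ : (m : ℝ) < n := by linarith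
  have h₃ : (n : ℝ) ≤ (m + 1 : ℕ) := by push_cast; linarith
  have h₄ : n = m + 1 := le_antisymm (by exact_mod_cast h₃) (by exact_mod_cast h₂)
  rw [h₄] at h
  push_cast at h
  linarith

/-- A direction along which all tight constraints at a positive extreme point of `Q` stay tight
is zero. -/
lemma eq_zero_of_mem_extremePoints_QPolytope {α : Type*} [DecidableEq α]
    {M : FinMatroid α} {Z : Finset α} {L : ℕ} {y : α → ℝ}
    (hvert : y ∈ Set.extremePoints ℝ (QPolytope M Z L)) (hy : ∀ e ∈ M.E, 0 < y e)
    {d : α → ℝ} (hd : ∀ e ∉ M.E, d e = 0) (htight : ∀ U, M.Tight y U → ∑ e ∈ U, d e = 0)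
    (hZ : ∑ e ∈ Z, d e = 0 ∨ (L : ℝ) < ∑ e ∈ Z, y e) : d = 0 := by
  obtain ⟨⟨-, hsupp, hE, hle, hL⟩, hext⟩ := hvert
  have hsum : ∀ (U : Finset α) (t : ℝ),
      ∑ e ∈ U, (y + t • d) e = ∑ e ∈ U, y e + t * ∑ e ∈ U, d e := fun U t => by
    simp [sum_add_distrib, mul_sum]
  have hcont : ∀ a b : ℝ, Filter.Tendsto (fun t : ℝ => a + t * b) (nhds 0) (nhds a) :=
    fun a b => by
      have h : Continuous fun t : ℝ => a + t * b := by fun_prop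
      simpa using h.tendsto 0
  have hmem : ∀ᶠ t : ℝ in nhds 0, y + t • d ∈ QPolytope M Z L := by
    have h₁ : ∀ᶠ t : ℝ in nhds 0, ∀ e ∈ M.E, 0 ≤ y e + t * d e :=
      (Filter.eventually_all_finset _).2 fun e he =>
        ((hcont _ _).eventually_const_lt (hy e he)).mono fun _ h => h.le
    have h₂ : ∀ᶠ t : ℝ in nhds 0, ∀ U ∈ M.E.ssubsets,
        ∑ e ∈ U, y e + t * ∑ e ∈ U, d e ≤ M.rank U := by
      refine (Filter.eventually_all_finset _).2 fun U hU => ?_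
      have hUE := mem_ssubsets.1 hU
      rcases (hle U hUE).eq_or_lt with h | h
      · simp [htight U ⟨hUE.1, h⟩, h]
      · exact ((hcont _ _).eventually_lt_const h).mono fun _ h => h.le
    have h₃ : ∀ᶠ t : ℝ in nhds 0, (L : ℝ) ≤ ∑ e ∈ Z, y e + t * ∑ e ∈ Z, d e := by
      rcases hZ with h | h
      · simp [h, hL]
      · exact ((hcont _ _).eventually_const_lt h).mono fun _ h => h.le
    filter_upwards [h₁, h₂, h₃] with t h₁ h₂ h₃
    refine ⟨fun e => ?_, fun e he => by simp [hsupp e he, hd e he], ?_, fun U hU => ?_, ?_⟩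
    · by_cases he : e ∈ M.E
      · simpa using h₁ e he
      · simp [hsupp e he, hd e he]
    · rw [hsum, htight M.E ⟨Subset.rfl, hE⟩, hE, mul_zero, add_zero]
    · rw [hsum]
      exact h₂ U (mem_ssubsets.2 hU)
    · rwa [hsum]
  obtain ⟨ε, hε, hball⟩ := Metric.eventually_nhds_iff.1 hmem
  have hpos : y + (ε / 2) • d ∈ QPolytope M Z L :=
    hball (by rw [Real.dist_eq, sub_zero, abs_of_pos] <;> linarith)
  have hneg : y + (-(ε / 2)) • d ∈ QPolytope M Z L :=
    hball (by rw [Real.dist_eq, sub_zero, abs_neg, abs_of_pos] <;> linarith)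
  have hseg : y ∈ openSegment ℝ (y + (ε / 2) • d) (y + (-(ε / 2)) • d) :=
    ⟨1 / 2, 1 / 2, by norm_num, by norm_num, by norm_num, by
      ext e
      simp only [Pi.add_apply, Pi.smul_apply, smul_eq_mul]
      ring⟩
  have h := hext hpos hneg hseg
  ext e
  have he := congrFun h e
  simp only [Pi.add_apply, Pi.smul_apply, smul_eq_mul, add_eq_left, mul_eq_zero] at he
  exact he.resolve_left (by positivity)

/-- If `y` is a vertex solution of `Q` with `y_e > 0` for every
`e ∈ E_Y` and `E_Y` is nonempty, then some `y_{e'} = 1` for an element `e' ∈ E_Y`. -/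
theorem vertex_of_matroid_Q_has_integral_coordinate {α : Type*} [DecidableEq α]
    (MY : FinMatroid α) (EZ : Finset α) (L : ℕ)
    (hEYne : MY.E.Nonempty)
    (hEZ : EZ ⊆ MY.E) (hL : L ≤ EZ.card)
    (y : α → ℝ)
    (hvert : y ∈ Set.extremePoints ℝ (QPolytope MY EZ L))
    (hy : ∀ e ∈ MY.E, 0 < y e) :
    ∃ e' ∈ MY.E, y e' = 1 := by
  by_contra! hne
  obtain ⟨-, -, hE, hlt, hLZ⟩ := hvert.1
  have hle : ∀ U ⊆ MY.E, ∑ e ∈ U, y e ≤ MY.rank U := fun U hU => by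
    rcases hU.eq_or_ssubset with rfl | h
    · exact hE.le
    · exact hlt U h
  have hEt : MY.Tight y MY.E := ⟨Subset.rfl, hE⟩
  have hy₁ : ∀ e ∈ MY.E, y e ≤ 1 := fun e he => by
    have h₁ := hle {e} (singleton_subset_iff.2 he)
    have h₂ : (MY.rank {e} : ℝ) ≤ 1 := by exact_mod_cast MY.rank_le_card {e}
    rw [sum_singleton] at h₁
    exact h₁.trans h₂
  have hnat : ∀ e ∈ MY.E, ∀ m n : ℕ, y e + m ≠ n := fun e he m n h =>
    hne e he (eq_one_of_add_natCast_eq h (hy e he) (hy₁ e he))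
  have hpartner : ∀ e ∈ MY.E, ∃ f ∈ MY.E, f ≠ e ∧ ∀ U, MY.Tight y U → (e ∈ U ↔ f ∈ U) := by
    intro e he
    by_contra! h
    obtain ⟨m, n, hmn⟩ := FinMatroid.exists_add_eq_of_separated hle hEt he fun f hf hfe => by
      obtain ⟨U, hU, h'⟩ := h f hf hfe
      exact ⟨U, hU, by tauto⟩
    exact hnat e he m n hmn
  have hslack : ∀ a ∈ MY.E, ∀ b ∈ MY.E, b ≠ a → (∀ U, MY.Tight y U → (a ∈ U ↔ b ∈ U)) →
      ¬((a ∈ EZ ↔ b ∈ EZ) ∨ (L : ℝ) < ∑ e ∈ EZ, y e) := by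
    intro a ha b hb hba hab h
    have h₀ := eq_zero_of_mem_extremePoints_QPolytope hvert hy
      (d := Pi.single a 1 - Pi.single b 1)
      (fun e he => by
        simp [(ne_of_mem_of_not_mem ha he).symm,
          (ne_of_mem_of_not_mem hb he).symm])
      (fun U hU => by simp [hab U hU])
      (h.imp_left fun h => by simp [h])
    simpa [hba.symm] using congrFun h₀ a
  have hpair : ∀ e ∈ MY.E, ∃ a ∈ MY.E, ∃ b ∈ MY.E, a ∈ EZ ∧ b ∉ EZ ∧ (e = a ∨ e = b) ∧
      ∀ U, MY.Tight y U → (a ∈ U ↔ b ∈ U) := by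
    intro e he
    obtain ⟨f, hf, hfe, hef⟩ := hpartner e he
    have h := hslack e he f hf hfe hef
    by_cases heZ : e ∈ EZ
    · exact ⟨e, he, f, hf, heZ, by tauto, Or.inl rfl, hef⟩
    · exact ⟨f, hf, e, he, by tauto, heZ, Or.inr rfl, fun U hU => (hef U hU).symm⟩
  obtain ⟨e, he⟩ := hEYne
  obtain ⟨a, ha, b, hb, haZ, hbZ, -, hab⟩ := hpair e he
  have hLeq : ∑ e ∈ EZ, y e = L := by
    have h := hslack a ha b hb (ne_of_mem_of_not_mem haZ hbZ).symm hab
    exact le_antisymm (not_lt.1 fun h' => h (Or.inr h')) hLZ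
  by_cases hZa : EZ = {a}
  · refine hnat a ha 0 L ?_
    rw [← hLeq, hZa, sum_singleton, Nat.cast_zero, add_zero]
  obtain ⟨c, hcZ, hca⟩ : ∃ c ∈ EZ, c ≠ a := by
    by_contra! h
    exact hZa (eq_singleton_iff_unique_mem.2 ⟨haZ, h⟩)
  obtain ⟨c', hc, f, hf, hc'Z, hfZ, hcf, hcft⟩ := hpair c (hEZ hcZ)
  obtain rfl : c = c' := hcf.resolve_right (ne_of_mem_of_not_mem hcZ hfZ)
  have h₀ := eq_zero_of_mem_extremePoints_QPolytope hvert hy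
    (d := (Pi.single a 1 - Pi.single b 1) - (Pi.single c 1 - Pi.single f 1))
    (fun e he => by
      simp [(ne_of_mem_of_not_mem ha he).symm,
        (ne_of_mem_of_not_mem hb he).symm, (ne_of_mem_of_not_mem hc he).symm,
        (ne_of_mem_of_not_mem hf he).symm])
    (fun U hU => by simp [hab U hU, hcft U hU])
    (Or.inl (by simp [haZ, hbZ, hcZ, hfZ]))
  simpa [hca.symm, ne_of_mem_of_not_mem haZ hbZ, ne_of_mem_of_not_mem haZ hfZ]
    using congrFun h₀ a
end
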